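/- (Detection loophole, arbitrary additional event efficiency.) Let S, T be finite index sets with real coefficients α_{st}, β_{st}, γ_{st}, let K > 0 and η ∈ (0,1]. Let ideal probabilities P_i^{st} (s ∈ S, t ∈ T) and P_i^{AB} be real numbers with P_i^{AB} > 0, and define the measured values P_m^{st} = η·P_i^{st} + (1−η)/4 and P_m^{AB} = η·P_i^{AB} + (1−η)/4; assume P_m^{AB} > 0. For c ∈ {α, β, γ} and x ∈ {i, m}, set I_c^x = Σ_{s,t} c_{st}·P_x^{st} and 𝒬_c = ((1−η)/4)·Σ_{s,t} c_{st}, and define N_x = I_α^x − (1/(K·P_x^{AB}))·[(I_β^x)² + (I_γ^x)²]. If N_i < 0, then N_m < 1/(K·(P_m^{AB} − (1−η)/4)) · [(I_β^m − 𝒬_β)² + (I_γ^m − 𝒬_γ)²] − (1/(K·P_m^{AB}))·[(I_β^m)² + (I_γ^m)²] + 𝒬_α. -/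

import Mathlib

open Matrix Kronecker BigOperators ComplexOrder

noncomputable section

/-- A density matrix: a positive semidefinite complex matrix with trace 1. -/
def IsDensity {n : Type*} [Fintype n] (ρ : Matrix n n ℂ) : Prop :=
  ρ.PosSemidef ∧ ρ.trace = 1

/-- A separable density matrix on a product index type. -/
def IsSepDensity {α β : Type*} [Fintype α] [Fintype β]
    (ρ : Matrix (α × β) (α × β) ℂ) : Prop :=
  ∃ (m : ℕ) (p : Fin m → ℝ) (σA : Fin m → Matrix α α ℂ) (σB : Fin m → Matrix β β ℂ),
    (∀ i, 0 ≤ p i) ∧ (∑ i, p i) = 1 ∧ (∀ i, IsDensity (σA i)) ∧ (∀ i, IsDensity (σB i)) ∧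
    ρ = ∑ i, (p i : ℂ) • (σA i ⊗ₖ σB i)

/-- A separable positive semidefinite operator: a finite sum of Kronecker products of
positive semidefinite matrices. -/
def IsSepPSD {α β : Type*} [Fintype α] [Fintype β]
    (ρ : Matrix (α × β) (α × β) ℂ) : Prop :=
  ∃ (m : ℕ) (C : Fin m → Matrix α α ℂ) (D : Fin m → Matrix β β ℂ),
    (∀ i, (C i).PosSemidef) ∧ (∀ i, (D i).PosSemidef) ∧ ρ = ∑ i, C i ⊗ₖ D i

/-- `Λa` is the Hilbert–Schmidt adjoint of `Λ`. -/
def IsHSAdjoint {n : Type*} [Fintype n]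
    (Λ Λa : Matrix n n ℂ →ₗ[ℂ] Matrix n n ℂ) : Prop :=
  ∀ M N : Matrix n n ℂ, (M * Λ N).trace = (Λa M * N).trace

/-- The operator `τ ⊗ ρ ⊗ ω` with Alice's two tensor factors and Bob's two tensor
factors grouped together. -/
def Mop {α β : Type*} (τ : Matrix α α ℂ) (ρ : Matrix (α × β) (α × β) ℂ)
    (ω : Matrix β β ℂ) : Matrix ((α × α) × (β × β)) ((α × α) × (β × β)) ℂ :=
  Matrix.of fun x y =>
    τ x.1.1 y.1.1 * ρ (x.1.2, x.2.1) (y.1.2, y.2.1) * ω x.2.2 y.2.2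

/-- Partial trace over the second tensor factor. -/
def ptr2 {α β : Type*} [Fintype β] (A : Matrix (α × β) (α × β) ℂ) : Matrix α α ℂ :=
  Matrix.of fun a a' => ∑ b, A (a, b) (a', b)

/-- Partial trace over the first tensor factor. -/
def ptr1 {α β : Type*} [Fintype α] (A : Matrix (α × β) (α × β) ℂ) : Matrix β β ℂ :=
  Matrix.of fun b b' => ∑ a, A (a, b) (a, b')

/-- Partial transpose on the second subsystem. -/
def ptB {α β : Type*} (M : Matrix (α × β) (α × β) ℂ) : Matrix (α × β) (α × β) ℂ :=
  Matrix.of fun x y => M (x.1, y.2) (y.1, x.2)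


/-- A weighted double sum transforms affinely when its entries do. -/
theorem sum_sum_mul_affine {S T : Type*} [Fintype S] [Fintype T]
    (w P Q : S → T → ℝ) (η q : ℝ) (h : ∀ s t, Q s t = η * P s t + q) :
    ∑ s, ∑ t, w s t * Q s t = η * (∑ s, ∑ t, w s t * P s t) + q * ∑ s, ∑ t, w s t := by
  simp only [h, Finset.mul_sum, ← Finset.sum_add_distrib]
  exact Finset.sum_congr rfl fun s _ => Finset.sum_congr rfl fun t _ => by ring

/-- Detection loophole with arbitrary additional event efficiency `η = η₊`. -/
theorem detection_loophole_additional_events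
    {S T : Type*} [Fintype S] [Fintype T]
    (a b c : S → T → ℝ) (K η : ℝ) (hK : 0 < K) (hη : 0 < η) (hη1 : η ≤ 1)
    (Pi : S → T → ℝ) (PiAB : ℝ) (hPiAB : 0 < PiAB)
    (Pm : S → T → ℝ) (PmAB : ℝ)
    (hPm : ∀ s t, Pm s t = η * Pi s t + (1 - η) / 4)
    (hPmAB : PmAB = η * PiAB + (1 - η) / 4)
    (hPmABpos : 0 < PmAB)
    (hNi : (∑ s, ∑ t, a s t * Pi s t) - (1 / (K * PiAB)) *
        ((∑ s, ∑ t, b s t * Pi s t) ^ 2 + (∑ s, ∑ t, c s t * Pi s t) ^ 2) < 0) :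
    (∑ s, ∑ t, a s t * Pm s t) - (1 / (K * PmAB)) *
        ((∑ s, ∑ t, b s t * Pm s t) ^ 2 + (∑ s, ∑ t, c s t * Pm s t) ^ 2)
      < 1 / (K * (PmAB - (1 - η) / 4)) *
          (((∑ s, ∑ t, b s t * Pm s t) - ((1 - η) / 4) * ∑ s, ∑ t, b s t) ^ 2
            + ((∑ s, ∑ t, c s t * Pm s t) - ((1 - η) / 4) * ∑ s, ∑ t, c s t) ^ 2)
        - (1 / (K * PmAB)) *
            ((∑ s, ∑ t, b s t * Pm s t) ^ 2 + (∑ s, ∑ t, c s t * Pm s t) ^ 2)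
        + ((1 - η) / 4) * ∑ s, ∑ t, a s t := by
  have hb := sum_sum_mul_affine b Pi Pm η _ hPm
  have hc := sum_sum_mul_affine c Pi Pm η _ hPm
  have ha := sum_sum_mul_affine a Pi Pm η _ hPm
  have hAB : PmAB - (1 - η) / 4 = η * PiAB := by rw [hPmAB]; ring
  have key := mul_neg_of_pos_of_neg hη hNi
  have hscale : ∀ x y : ℝ, 1 / (K * (η * PiAB)) * ((η * x) ^ 2 + (η * y) ^ 2)
      = η * (1 / (K * PiAB) * (x ^ 2 + y ^ 2)) := by
    intro x y
    field_simp
  rw [hAB, sub_eq_of_eq_add hb, sub_eq_of_eq_add hc, hscale, ha]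
  linarith

end
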